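/- For every ν ∈ ℝ, define for each contact Hamiltonian f among 1, x, θ₁, θ₂, θ₁θ₂, x², xθ₁, xθ₂ the operator 𝕃_f on A ⊕ A by 𝕃_f(F₁, F₂) = (L_f F₁ − (1/2)D̄₁(D̄₂(f))F₂, L_f F₂ + (1/2)D̄₁(D̄₂(f))F₁), where L_f = X_f + ν f′. Then the Casimir combination −(1/2)𝕃_{x²}∘𝕃_1 − 𝕃_{xθ₁}∘𝕃_{θ₁} − 𝕃_{xθ₂}∘𝕃_{θ₂} + 𝕃_x∘𝕃_x + 𝕃_{θ₁θ₂}∘𝕃_{θ₁θ₂} + 𝕃_{θ₁}∘𝕃_{xθ₁} + 𝕃_{θ₂}∘𝕃_{xθ₂} − (1/2)𝕃_1∘𝕃_{x²} equals (ν² − 1/4) · Id as an operator on A ⊕ A. (Applied with ν = δ − k, this says the Casimir operator of spo(2|2) acts on the symbol space of half-odd-integer degree k as α_k = (δ − k)² − 1/4 times the identity.) -/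

import Mathlib

/-! Model of the superfunctions on the supercircle `S^{1|2}`:
quadruples `f = (f₀, f₁, f₂, f₁₂)` of functions `ℝ → ℝ`, thought of as
`f = f₀ + θ₁f₁ + θ₂f₂ + θ₁θ₂f₁₂` with Grassmann relations
`θ₁θ₂ = −θ₂θ₁`, `θ₁² = θ₂² = 0`. -/
abbrev SF : Type := (ℝ → ℝ) × (ℝ → ℝ) × (ℝ → ℝ) × (ℝ → ℝ)

namespace SF

/-- the coefficient `f₀`. -/
def c0 (f : SF) : ℝ → ℝ := f.1
/-- the coefficient `f₁` of `θ₁`. -/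
def c1 (f : SF) : ℝ → ℝ := f.2.1
/-- the coefficient `f₂` of `θ₂`. -/
def c2 (f : SF) : ℝ → ℝ := f.2.2.1
/-- the coefficient `f₁₂` of `θ₁θ₂`. -/
def c12 (f : SF) : ℝ → ℝ := f.2.2.2

/-- a superfunction is smooth if its four components are. -/
def Smooth (f : SF) : Prop :=
  ContDiff ℝ (⊤ : ℕ∞) f.c0 ∧ ContDiff ℝ (⊤ : ℕ∞) f.c1 ∧
    ContDiff ℝ (⊤ : ℕ∞) f.c2 ∧ ContDiff ℝ (⊤ : ℕ∞) f.c12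

/-- the associative product
`(f₀+θ₁f₁+θ₂f₂+θ₁θ₂f₁₂)(g₀+θ₁g₁+θ₂g₂+θ₁θ₂g₁₂)` determined by the
Grassmann relations `θ₁θ₂ = −θ₂θ₁`, `θ₁² = θ₂² = 0`. -/
def mul (f g : SF) : SF :=
  (f.c0 * g.c0,
   f.c0 * g.c1 + f.c1 * g.c0,
   f.c0 * g.c2 + f.c2 * g.c0,
   f.c0 * g.c12 + f.c12 * g.c0 + f.c1 * g.c2 - f.c2 * g.c1)

/-- `∂ₓ` differentiates each component. -/
noncomputable def dx (f : SF) : SF := (deriv f.c0, deriv f.c1, deriv f.c2, deriv f.c12)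

/-- `∂_{θ₁} f = f₁ + θ₂ f₁₂`. -/
def dθ1 (f : SF) : SF := (f.c1, 0, f.c12, 0)

/-- `∂_{θ₂} f = f₂ − θ₁ f₁₂`. -/
def dθ2 (f : SF) : SF := (f.c2, -f.c12, 0, 0)

/-- the odd coordinate `θ₁` as a superfunction. -/
def θ1 : SF := (0, 1, 0, 0)
/-- the odd coordinate `θ₂` as a superfunction. -/
def θ2 : SF := (0, 0, 1, 0)

/-- `D̄₁ = ∂_{θ₁} − θ₁ ∂ₓ`. -/
noncomputable def D1 (f : SF) : SF := dθ1 f - mul θ1 (dx f)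

/-- `D̄₂ = ∂_{θ₂} − θ₂ ∂ₓ`. -/
noncomputable def D2 (f : SF) : SF := dθ2 f - mul θ2 (dx f)

/-- the contact vector field `X_f = f ∂ₓ − (−1)^{f̃} (1/2)(D̄₁(f) D̄₁ + D̄₂(f) D̄₂)`
of a homogeneous contact Hamiltonian `f` of parity `ε`. -/
noncomputable def X (ε : ℕ) (f : SF) (g : SF) : SF :=
  mul f (dx g) -
    ((-1 : ℝ) ^ ε * (1 / 2 : ℝ)) • (mul (D1 f) (D1 g) + mul (D2 f) (D2 g))

/-- `f` is even: `f₁ = f₂ = 0`. -/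
def IsEven (f : SF) : Prop := f.c1 = 0 ∧ f.c2 = 0

/-- `f` is odd: `f₀ = f₁₂ = 0`. -/
def IsOdd (f : SF) : Prop := f.c0 = 0 ∧ f.c12 = 0

/-- `f` is homogeneous of parity `ε`. -/
def Homog (ε : ℕ) (f : SF) : Prop := if ε % 2 = 0 then IsEven f else IsOdd f

/-- the contact Hamiltonian `1`. -/
def hOne : SF := (1, 0, 0, 0)
/-- the contact Hamiltonian `x`. -/
def hX : SF := (fun x => x, 0, 0, 0)
/-- the contact Hamiltonian `θ₁`. -/
def hθ1 : SF := θ1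
/-- the contact Hamiltonian `θ₂`. -/
def hθ2 : SF := θ2
/-- the contact Hamiltonian `θ₁θ₂`. -/
def hθ1θ2 : SF := (0, 0, 0, 1)
/-- the contact Hamiltonian `x²`. -/
def hX2 : SF := (fun x => x ^ 2, 0, 0, 0)
/-- the contact Hamiltonian `xθ₁`. -/
def hXθ1 : SF := (0, fun x => x, 0, 0)
/-- the contact Hamiltonian `xθ₂`. -/
def hXθ2 : SF := (0, 0, fun x => x, 0)

end SF

namespace SF

/-- the weight-`ν` action `L_f = X_f + ν f′` of a homogeneous contact Hamiltonian `f`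
of parity `ε` (with `f′ = ∂ₓ(f)` acting by left multiplication). -/
noncomputable def L (ε : ℕ) (f : SF) (ν : ℝ) (g : SF) : SF :=
  X ε f g + ν • mul (dx f) g

/-- the twisted action on pairs (symbols of half-odd-integer degree):
`𝕃_f(F₁, F₂) = (L_f F₁ − (1/2)D̄₁(D̄₂(f))F₂, L_f F₂ + (1/2)D̄₁(D̄₂(f))F₁)`. -/
noncomputable def LL (ε : ℕ) (f : SF) (ν : ℝ) (F : SF × SF) : SF × SF :=
  (L ε f ν F.1 - (1 / 2 : ℝ) • mul (D1 (D2 f)) F.2,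
   L ε f ν F.2 + (1 / 2 : ℝ) • mul (D1 (D2 f)) F.1)

end SF

namespace SF

theorem D1_D2_hOne : D1 (D2 hOne) = 0 := by
  refine Prod.ext ?_ (Prod.ext ?_ (Prod.ext ?_ ?_)) <;> funext x <;>
    simp [hOne, c0, c1, c2, c12, θ1, θ2, D1, D2, mul, dx, dθ1, dθ2]

theorem L_hOne (ν : ℝ) (a b c d : ℝ → ℝ) :
    L 0 hOne ν (a, b, c, d) =
      (fun x => deriv a x,
       fun x => deriv b x,
       fun x => deriv c x,
       fun x => deriv d x) := by
  refine Prod.ext ?_ (Prod.ext ?_ (Prod.ext ?_ ?_)) <;> funext x <;>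
    simp [hOne, L, X, c0, c1, c2, c12, θ1, θ2, D1, D2, mul, dx, dθ1, dθ2]

theorem LL_hOne (ν : ℝ) (a b c d p q r s : ℝ → ℝ) :
    LL 0 hOne ν ((a, b, c, d), (p, q, r, s)) =
      ((fun x => deriv a x,
        fun x => deriv b x,
        fun x => deriv c x,
        fun x => deriv d x),
       (fun x => deriv p x,
        fun x => deriv q x,
        fun x => deriv r x,
        fun x => deriv s x)) := by
  simp only [LL, L_hOne, D1_D2_hOne]
  refine Prod.ext (Prod.ext ?_ (Prod.ext ?_ (Prod.ext ?_ ?_)))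
    (Prod.ext ?_ (Prod.ext ?_ (Prod.ext ?_ ?_))) <;> funext x <;>
    simp [mul, c0, c1, c2, c12]

theorem D1_D2_hX : D1 (D2 hX) = 0 := by
  refine Prod.ext ?_ (Prod.ext ?_ (Prod.ext ?_ ?_)) <;> funext x <;>
    simp [hX, c0, c1, c2, c12, θ1, θ2, D1, D2, mul, dx, dθ1, dθ2, Pi.neg_def]

theorem L_hX (ν : ℝ) (a b c d : ℝ → ℝ) :
    L 0 hX ν (a, b, c, d) =
      (fun x => x * deriv a x + ν * a x,
       fun x => x * deriv b x + (ν + 1 / 2) * b x,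
       fun x => x * deriv c x + (ν + 1 / 2) * c x,
       fun x => x * deriv d x + (ν + 1) * d x) := by
  refine Prod.ext ?_ (Prod.ext ?_ (Prod.ext ?_ ?_)) <;> funext x <;>
    simp [hX, L, X, c0, c1, c2, c12, θ1, θ2, D1, D2, mul, dx, dθ1, dθ2] <;> ring

theorem LL_hX (ν : ℝ) (a b c d p q r s : ℝ → ℝ) :
    LL 0 hX ν ((a, b, c, d), (p, q, r, s)) =
      ((fun x => x * deriv a x + ν * a x,
        fun x => x * deriv b x + (ν + 1 / 2) * b x,
        fun x => x * deriv c x + (ν + 1 / 2) * c x,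
        fun x => x * deriv d x + (ν + 1) * d x),
       (fun x => x * deriv p x + ν * p x,
        fun x => x * deriv q x + (ν + 1 / 2) * q x,
        fun x => x * deriv r x + (ν + 1 / 2) * r x,
        fun x => x * deriv s x + (ν + 1) * s x)) := by
  simp only [LL, L_hX, D1_D2_hX]
  refine Prod.ext (Prod.ext ?_ (Prod.ext ?_ (Prod.ext ?_ ?_)))
    (Prod.ext ?_ (Prod.ext ?_ (Prod.ext ?_ ?_))) <;> funext x <;>
    simp [mul, c0, c1, c2, c12]

theorem D1_D2_hX2 : D1 (D2 hX2) = (0, 0, 0, 2) := by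
  refine Prod.ext ?_ (Prod.ext ?_ (Prod.ext ?_ ?_)) <;> funext x <;>
    simp [hX2, c0, c1, c2, c12, θ1, θ2, D1, D2, mul, dx, dθ1, dθ2, Pi.neg_def]

theorem L_hX2 (ν : ℝ) (a b c d : ℝ → ℝ) :
    L 0 hX2 ν (a, b, c, d) =
      (fun x => x ^ 2 * deriv a x + 2 * ν * x * a x,
       fun x => x ^ 2 * deriv b x + (2 * ν + 1) * x * b x,
       fun x => x ^ 2 * deriv c x + (2 * ν + 1) * x * c x,
       fun x => x ^ 2 * deriv d x + (2 * ν + 2) * x * d x) := by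
  refine Prod.ext ?_ (Prod.ext ?_ (Prod.ext ?_ ?_)) <;> funext x <;>
    simp [hX2, L, X, c0, c1, c2, c12, θ1, θ2, D1, D2, mul, dx, dθ1, dθ2] <;> ring

theorem LL_hX2 (ν : ℝ) (a b c d p q r s : ℝ → ℝ) :
    LL 0 hX2 ν ((a, b, c, d), (p, q, r, s)) =
      ((fun x => x ^ 2 * deriv a x + 2 * ν * x * a x,
        fun x => x ^ 2 * deriv b x + (2 * ν + 1) * x * b x,
        fun x => x ^ 2 * deriv c x + (2 * ν + 1) * x * c x,
        fun x => x ^ 2 * deriv d x + (2 * ν + 2) * x * d x - p x),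
       (fun x => x ^ 2 * deriv p x + 2 * ν * x * p x,
        fun x => x ^ 2 * deriv q x + (2 * ν + 1) * x * q x,
        fun x => x ^ 2 * deriv r x + (2 * ν + 1) * x * r x,
        fun x => x ^ 2 * deriv s x + (2 * ν + 2) * x * s x + a x)) := by
  simp only [LL, L_hX2, D1_D2_hX2]
  refine Prod.ext (Prod.ext ?_ (Prod.ext ?_ (Prod.ext ?_ ?_)))
    (Prod.ext ?_ (Prod.ext ?_ (Prod.ext ?_ ?_))) <;> funext x <;>
    simp [mul, c0, c1, c2, c12]

theorem D1_D2_hθ1 : D1 (D2 hθ1) = 0 := by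
  refine Prod.ext ?_ (Prod.ext ?_ (Prod.ext ?_ ?_)) <;> funext x <;>
    simp [hθ1, c0, c1, c2, c12, θ1, θ2, D1, D2, mul, dx, dθ1, dθ2]

theorem L_hθ1 (ν : ℝ) (a b c d : ℝ → ℝ) :
    L 1 hθ1 ν (a, b, c, d) =
      (fun x => 1 / 2 * b x,
       fun x => 1 / 2 * deriv a x,
       fun x => 1 / 2 * d x,
       fun x => 1 / 2 * deriv c x) := by
  refine Prod.ext ?_ (Prod.ext ?_ (Prod.ext ?_ ?_)) <;> funext x <;>
    simp [hθ1, L, X, c0, c1, c2, c12, θ1, θ2, D1, D2, mul, dx, dθ1, dθ2] <;> ring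

theorem LL_hθ1 (ν : ℝ) (a b c d p q r s : ℝ → ℝ) :
    LL 1 hθ1 ν ((a, b, c, d), (p, q, r, s)) =
      ((fun x => 1 / 2 * b x,
        fun x => 1 / 2 * deriv a x,
        fun x => 1 / 2 * d x,
        fun x => 1 / 2 * deriv c x),
       (fun x => 1 / 2 * q x,
        fun x => 1 / 2 * deriv p x,
        fun x => 1 / 2 * s x,
        fun x => 1 / 2 * deriv r x)) := by
  simp only [LL, L_hθ1, D1_D2_hθ1]
  refine Prod.ext (Prod.ext ?_ (Prod.ext ?_ (Prod.ext ?_ ?_)))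
    (Prod.ext ?_ (Prod.ext ?_ (Prod.ext ?_ ?_))) <;> funext x <;>
    simp [mul, c0, c1, c2, c12]

theorem D1_D2_hθ2 : D1 (D2 hθ2) = 0 := by
  refine Prod.ext ?_ (Prod.ext ?_ (Prod.ext ?_ ?_)) <;> funext x <;>
    simp [hθ2, c0, c1, c2, c12, θ1, θ2, D1, D2, mul, dx, dθ1, dθ2]

theorem L_hθ2 (ν : ℝ) (a b c d : ℝ → ℝ) :
    L 1 hθ2 ν (a, b, c, d) =
      (fun x => 1 / 2 * c x,
       fun x => -(1 / 2) * d x,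
       fun x => 1 / 2 * deriv a x,
       fun x => -(1 / 2) * deriv b x) := by
  refine Prod.ext ?_ (Prod.ext ?_ (Prod.ext ?_ ?_)) <;> funext x <;>
    simp [hθ2, L, X, c0, c1, c2, c12, θ1, θ2, D1, D2, mul, dx, dθ1, dθ2] <;> ring

theorem LL_hθ2 (ν : ℝ) (a b c d p q r s : ℝ → ℝ) :
    LL 1 hθ2 ν ((a, b, c, d), (p, q, r, s)) =
      ((fun x => 1 / 2 * c x,
        fun x => -(1 / 2) * d x,
        fun x => 1 / 2 * deriv a x,
        fun x => -(1 / 2) * deriv b x),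
       (fun x => 1 / 2 * r x,
        fun x => -(1 / 2) * s x,
        fun x => 1 / 2 * deriv p x,
        fun x => -(1 / 2) * deriv q x)) := by
  simp only [LL, L_hθ2, D1_D2_hθ2]
  refine Prod.ext (Prod.ext ?_ (Prod.ext ?_ (Prod.ext ?_ ?_)))
    (Prod.ext ?_ (Prod.ext ?_ (Prod.ext ?_ ?_))) <;> funext x <;>
    simp [mul, c0, c1, c2, c12]

theorem D1_D2_hθ1θ2 : D1 (D2 hθ1θ2) = (-1, 0, 0, 0) := by
  refine Prod.ext ?_ (Prod.ext ?_ (Prod.ext ?_ ?_)) <;> funext x <;>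
    simp [hθ1θ2, c0, c1, c2, c12, θ1, θ2, D1, D2, mul, dx, dθ1, dθ2, Pi.neg_def]

theorem L_hθ1θ2 (ν : ℝ) (a b c d : ℝ → ℝ) :
    L 0 hθ1θ2 ν (a, b, c, d) =
      (fun _ => 0,
       fun x => 1 / 2 * c x,
       fun x => -(1 / 2) * b x,
       fun _ => 0) := by
  refine Prod.ext ?_ (Prod.ext ?_ (Prod.ext ?_ ?_)) <;> funext x <;>
    simp [hθ1θ2, L, X, c0, c1, c2, c12, θ1, θ2, D1, D2, mul, dx, dθ1, dθ2]; ring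

theorem LL_hθ1θ2 (ν : ℝ) (a b c d p q r s : ℝ → ℝ) :
    LL 0 hθ1θ2 ν ((a, b, c, d), (p, q, r, s)) =
      ((fun x => 1 / 2 * p x,
        fun x => 1 / 2 * c x + 1 / 2 * q x,
        fun x => -(1 / 2) * b x + 1 / 2 * r x,
        fun x => 1 / 2 * s x),
       (fun x => -(1 / 2 * a x),
        fun x => 1 / 2 * r x - 1 / 2 * b x,
        fun x => -(1 / 2) * q x - 1 / 2 * c x,
        fun x => -(1 / 2 * d x))) := by
  simp only [LL, L_hθ1θ2, D1_D2_hθ1θ2]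
  refine Prod.ext (Prod.ext ?_ (Prod.ext ?_ (Prod.ext ?_ ?_)))
    (Prod.ext ?_ (Prod.ext ?_ (Prod.ext ?_ ?_))) <;> funext x <;>
    simp [mul, c0, c1, c2, c12] <;> ring

theorem D1_D2_hXθ1 : D1 (D2 hXθ1) = θ2 := by
  refine Prod.ext ?_ (Prod.ext ?_ (Prod.ext ?_ ?_)) <;> funext x <;>
    simp [hXθ1, c0, c1, c2, c12, θ1, θ2, D1, D2, mul, dx, dθ1, dθ2, Pi.neg_def]

theorem L_hXθ1 (ν : ℝ) (a b c d : ℝ → ℝ) :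
    L 1 hXθ1 ν (a, b, c, d) =
      (fun x => 1 / 2 * x * b x,
       fun x => 1 / 2 * x * deriv a x + ν * a x,
       fun x => 1 / 2 * x * d x,
       fun x => 1 / 2 * x * deriv c x + (ν + 1 / 2) * c x) := by
  refine Prod.ext ?_ (Prod.ext ?_ (Prod.ext ?_ ?_)) <;> funext x <;>
    simp [hXθ1, L, X, c0, c1, c2, c12, θ1, θ2, D1, D2, mul, dx, dθ1, dθ2] <;> ring

theorem LL_hXθ1 (ν : ℝ) (a b c d p q r s : ℝ → ℝ) :
    LL 1 hXθ1 ν ((a, b, c, d), (p, q, r, s)) =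
      ((fun x => 1 / 2 * x * b x,
        fun x => 1 / 2 * x * deriv a x + ν * a x,
        fun x => 1 / 2 * x * d x - 1 / 2 * p x,
        fun x => 1 / 2 * x * deriv c x + (ν + 1 / 2) * c x + 1 / 2 * q x),
       (fun x => 1 / 2 * x * q x,
        fun x => 1 / 2 * x * deriv p x + ν * p x,
        fun x => 1 / 2 * x * s x + 1 / 2 * a x,
        fun x => 1 / 2 * x * deriv r x + (ν + 1 / 2) * r x - 1 / 2 * b x)) := by
  simp only [LL, L_hXθ1, D1_D2_hXθ1]
  refine Prod.ext (Prod.ext ?_ (Prod.ext ?_ (Prod.ext ?_ ?_)))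
    (Prod.ext ?_ (Prod.ext ?_ (Prod.ext ?_ ?_))) <;> funext x <;>
    simp [mul, c0, c1, c2, c12, θ2]; ring

theorem D1_D2_hXθ2 : D1 (D2 hXθ2) = -θ1 := by
  refine Prod.ext ?_ (Prod.ext ?_ (Prod.ext ?_ ?_)) <;> funext x <;>
    simp [hXθ2, c0, c1, c2, c12, θ1, θ2, D1, D2, mul, dx, dθ1, dθ2, Pi.neg_def]

theorem L_hXθ2 (ν : ℝ) (a b c d : ℝ → ℝ) :
    L 1 hXθ2 ν (a, b, c, d) =
      (fun x => 1 / 2 * x * c x,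
       fun x => -(1 / 2) * x * d x,
       fun x => 1 / 2 * x * deriv a x + ν * a x,
       fun x => -(1 / 2) * x * deriv b x - (ν + 1 / 2) * b x) := by
  refine Prod.ext ?_ (Prod.ext ?_ (Prod.ext ?_ ?_)) <;> funext x <;>
    simp [hXθ2, L, X, c0, c1, c2, c12, θ1, θ2, D1, D2, mul, dx, dθ1, dθ2] <;> ring

theorem LL_hXθ2 (ν : ℝ) (a b c d p q r s : ℝ → ℝ) :
    LL 1 hXθ2 ν ((a, b, c, d), (p, q, r, s)) =
      ((fun x => 1 / 2 * x * c x,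
        fun x => -(1 / 2) * x * d x + 1 / 2 * p x,
        fun x => 1 / 2 * x * deriv a x + ν * a x,
        fun x => -(1 / 2) * x * deriv b x - (ν + 1 / 2) * b x + 1 / 2 * r x),
       (fun x => 1 / 2 * x * r x,
        fun x => -(1 / 2) * x * s x - 1 / 2 * a x,
        fun x => 1 / 2 * x * deriv p x + ν * p x,
        fun x => -(1 / 2) * x * deriv q x - (ν + 1 / 2) * q x - 1 / 2 * c x)) := by
  simp only [LL, L_hXθ2, D1_D2_hXθ2]
  refine Prod.ext (Prod.ext ?_ (Prod.ext ?_ (Prod.ext ?_ ?_)))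
    (Prod.ext ?_ (Prod.ext ?_ (Prod.ext ?_ ?_))) <;> funext x <;>
    simp [mul, c0, c1, c2, c12, θ1] <;> ring

end SF

set_option maxHeartbeats 4000000 in
open SF in
/-- The Casimir combination
`−(1/2)𝕃_{x²}∘𝕃_1 − 𝕃_{xθ₁}∘𝕃_{θ₁} − 𝕃_{xθ₂}∘𝕃_{θ₂} + 𝕃_x∘𝕃_x + 𝕃_{θ₁θ₂}∘𝕃_{θ₁θ₂}
+ 𝕃_{θ₁}∘𝕃_{xθ₁} + 𝕃_{θ₂}∘𝕃_{xθ₂} − (1/2)𝕃_1∘𝕃_{x²}` of the twisted weight-`ν`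
actions equals `(ν² − 1/4) · Id` as an operator on `A ⊕ A`. -/
theorem casimir_on_pairs (ν : ℝ) :
    ∀ F : SF × SF, Smooth F.1 → Smooth F.2 →
      -((1 / 2 : ℝ)) • LL 0 hX2 ν (LL 0 hOne ν F) -
        LL 1 hXθ1 ν (LL 1 hθ1 ν F) -
        LL 1 hXθ2 ν (LL 1 hθ2 ν F) +
        LL 0 hX ν (LL 0 hX ν F) +
        LL 0 hθ1θ2 ν (LL 0 hθ1θ2 ν F) +
        LL 1 hθ1 ν (LL 1 hXθ1 ν F) +
        LL 1 hθ2 ν (LL 1 hXθ2 ν F) -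
        (1 / 2 : ℝ) • LL 0 hOne ν (LL 0 hX2 ν F) =
      (ν ^ 2 - 1 / 4) • F := by
  rintro ⟨⟨a, b, c, d⟩, ⟨p, q, r, s⟩⟩ ⟨ha, hb, hc, hd⟩ ⟨hp, hq, hr, hs⟩
  have D0 {f : ℝ → ℝ} (h : ContDiff ℝ (⊤ : ℕ∞) f) (x : ℝ) : DifferentiableAt ℝ f x :=
    h.differentiable (by simp) x
  have D1 {f : ℝ → ℝ} (h : ContDiff ℝ (⊤ : ℕ∞) f) (x : ℝ) : DifferentiableAt ℝ (deriv f) x :=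
    (contDiff_infty_iff_deriv.mp h).2.differentiable (by simp) x
  simp only [c0, c1, c2, c12] at ha hb hc hd hp hq hr hs
  have a0 := D0 ha
  have a1 := D1 ha
  have b0 := D0 hb
  have b1 := D1 hb
  have c0 := D0 hc
  have c1 := D1 hc
  have d0 := D0 hd
  have d1 := D1 hd
  have p0 := D0 hp
  have p1 := D1 hp
  have q0 := D0 hq
  have q1 := D1 hq
  have r0 := D0 hr
  have r1 := D1 hr
  have s0 := D0 hs
  have s1 := D1 hs
  simp only [LL_hOne, LL_hX, LL_hX2, LL_hθ1, LL_hθ2, LL_hθ1θ2, LL_hXθ1, LL_hXθ2]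
  refine Prod.ext (Prod.ext ?_ (Prod.ext ?_ (Prod.ext ?_ ?_)))
    (Prod.ext ?_ (Prod.ext ?_ (Prod.ext ?_ ?_))) <;> funext x <;>
    simp (disch := fun_prop) [deriv_fun_add, deriv_fun_sub, deriv_fun_mul] <;> ring
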